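/- Let q ∈ (0,1] and σ > 0. Let μ₀ be the probability density of the Gaussian distribution N(0, σ²) on ℝ, μ₁ the density of N(1, σ²), and μ = (1−q)·μ₀ + q·μ₁ the mixture density. Define A_α = E_{z∼μ₀}[(μ(z)/μ₀(z))^α] and B_α = E_{z∼μ}[(μ₀(z)/μ(z))^α]. Then for every α ≥ 1, A_α ≥ B_α; in particular max(A_α, B_α) = A_α, so the Rényi-divergence bound (1/(α−1)) · log max(A_α, B_α) for the Sampled Gaussian Mechanism equals ξ_N(α|q) := (1/(α−1)) · log A_α. -/

import Mathlib

open MeasureTheory ProbabilityTheory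

noncomputable section

/-- Density `μ₀` of the Gaussian `N(0, σ²)` on `ℝ`. -/
def mu0 (σ : ℝ) (z : ℝ) : ℝ := gaussianPDFReal 0 ((σ ^ 2).toNNReal) z

/-- Density `μ₁` of the Gaussian `N(1, σ²)` on `ℝ`. -/
def mu1 (σ : ℝ) (z : ℝ) : ℝ := gaussianPDFReal 1 ((σ ^ 2).toNNReal) z

/-- The mixture density `μ = (1 - q)·μ₀ + q·μ₁`. -/
def muMix (q σ : ℝ) (z : ℝ) : ℝ := (1 - q) * mu0 σ z + q * mu1 σ z

/-- `A_α = E_{z ∼ μ₀} [(μ(z)/μ₀(z))^α]`. -/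
def Amom (q σ α : ℝ) : ℝ := ∫ z : ℝ, mu0 σ z * (muMix q σ z / mu0 σ z) ^ α

/-- `B_α = E_{z ∼ μ} [(μ₀(z)/μ(z))^α]`. -/
def Bmom (q σ α : ℝ) : ℝ := ∫ z : ℝ, muMix q σ z * (mu0 σ z / muMix q σ z) ^ α

/-- `ξ_N(α|q) = (α−1)⁻¹ · log A_α`. -/
def xiN (q σ α : ℝ) : ℝ := (α - 1)⁻¹ * Real.log (Amom q σ α)

/-- `y ↦ y^α - y^(1-α)` is convex on `[1, ∞)` when `α ≥ 1`. -/
theorem convexOn_rpow_sub_rpow_one_sub {α : ℝ} (hα : 1 ≤ α) :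
    ConvexOn ℝ (Set.Ici 1) fun y : ℝ => y ^ α - y ^ (1 - α) := by
  have hderiv (p : ℝ) {y : ℝ} (hy : 1 < y) :
      HasDerivAt (fun y : ℝ => y ^ p) (p * y ^ (p - 1)) y :=
    Real.hasDerivAt_rpow_const (Or.inl (by linarith))
  refine convexOn_of_hasDerivWithinAt2_nonneg (convex_Ici 1)
    (f' := fun y => α * y ^ (α - 1) - (1 - α) * y ^ (1 - α - 1))
    (f'' := fun y => α * ((α - 1) * y ^ (α - 1 - 1)) -
      (1 - α) * ((1 - α - 1) * y ^ (1 - α - 1 - 1))) ?_ ?_ ?_ ?_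
  · intro y hy
    have hy0 : y ≠ 0 := by linarith [Set.mem_Ici.mp hy]
    exact ((Real.continuousAt_rpow_const y _ (Or.inl hy0)).sub
      (Real.continuousAt_rpow_const y _ (Or.inl hy0))).continuousWithinAt
  · intro y hy
    rw [interior_Ici] at hy
    exact ((hderiv _ hy).sub (hderiv _ hy)).hasDerivWithinAt
  · intro y hy
    rw [interior_Ici] at hy
    exact (((hderiv _ hy).const_mul _).sub ((hderiv _ hy).const_mul _)).hasDerivWithinAt
  · intro y hy
    rw [interior_Ici] at hy
    have hmono : y ^ (1 - α - 1 - 1) ≤ y ^ (α - 1 - 1) :=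
      Real.rpow_le_rpow_of_exponent_le (le_of_lt hy) (by linarith)
    have hcoef : 0 ≤ α * (α - 1) := mul_nonneg (by linarith) (by linarith)
    linear_combination mul_le_mul_of_nonneg_left hmono hcoef

theorem rpow_one_sub_mixture_le_of_one_le {q α x : ℝ} (hq0 : 0 ≤ q) (hq1 : q ≤ 1) (hα : 1 ≤ α)
    (hx : 1 ≤ x) :
    (1 - q + q * x) ^ (1 - α) + x * (1 - q + q * x⁻¹) ^ (1 - α) ≤
      (1 - q + q * x) ^ α + x * (1 - q + q * x⁻¹) ^ α := by
  have hx0 : 0 < x := by linarith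
  have ha : 1 ≤ 1 - q + q * x := by nlinarith
  have hd : 1 ≤ (1 - q) * x + q := by nlinarith
  set a := 1 - q + q * x with ha_def
  set d := (1 - q) * x + q with hd_def
  have hd0 : 0 < d := by linarith
  have hb : 1 - q + q * x⁻¹ = (x / d)⁻¹ := by
    rw [hd_def]; field_simp
  have hc0 : 0 < x / d := by positivity
  have hconv := (convexOn_rpow_sub_rpow_one_sub hα).2 (Set.mem_Ici.mpr le_rfl)
    (Set.mem_Ici.mpr ha) (sub_nonneg.mpr (inv_le_one_of_one_le₀ hd)) (inv_nonneg.mpr hd0.le)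
    (sub_add_cancel 1 d⁻¹)
  have hc : (1 - d⁻¹) • (1 : ℝ) + d⁻¹ • a = x / d := by
    simp only [smul_eq_mul]
    field_simp
    rw [ha_def, hd_def]; ring
  simp only [hc] at hconv
  simp only [Real.one_rpow, sub_self, smul_eq_mul, mul_zero, zero_add] at hconv
  have hmul : d * ((x / d) ^ α - (x / d) ^ (1 - α)) ≤ a ^ α - a ^ (1 - α) := by
    have := mul_le_mul_of_nonneg_left hconv hd0.le
    rwa [mul_inv_cancel_left₀ hd0.ne'] at this
  have hinv (p : ℝ) : x * ((x / d)⁻¹) ^ p = d * (x / d) ^ (1 - p) := by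
    rw [Real.inv_rpow hc0.le, Real.rpow_sub hc0, Real.rpow_one]
    have := (Real.rpow_pos_of_pos hc0 p).ne'
    field_simp
  rw [hb, hinv, hinv, sub_sub_cancel]
  linarith

theorem rpow_one_sub_mixture_le {q α x : ℝ} (hq0 : 0 ≤ q) (hq1 : q ≤ 1) (hα : 1 ≤ α)
    (hx : 0 < x) :
    (1 - q + q * x) ^ (1 - α) + x * (1 - q + q * x⁻¹) ^ (1 - α) ≤
      (1 - q + q * x) ^ α + x * (1 - q + q * x⁻¹) ^ α := by
  rcases le_total 1 x with h | h
  · exact rpow_one_sub_mixture_le_of_one_le hq0 hq1 hα h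
  · have key := mul_le_mul_of_nonneg_left
      (rpow_one_sub_mixture_le_of_one_le hq0 hq1 hα ((one_le_inv₀ hx).mpr h)) hx.le
    rw [inv_inv, mul_add, mul_add, mul_inv_cancel_left₀ hx.ne', mul_inv_cancel_left₀ hx.ne'] at key
    linarith

theorem mixture_pos {q x : ℝ} (hq0 : 0 < q) (hq1 : q ≤ 1) (hx : 0 < x) :
    0 < 1 - q + q * x :=
  add_pos_of_nonneg_of_pos (by linarith) (mul_pos hq0 hx)

theorem mixture_rpow_le {q x : ℝ} (hq0 : 0 < q) (hq1 : q ≤ 1) (hx : 0 < x) (p : ℝ) :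
    (1 - q + q * x) ^ p ≤ 1 + x ^ p := by
  have hpos := mixture_pos hq0 hq1 hx
  have hxp := Real.rpow_pos_of_pos hx p
  rcases le_total 0 p with hp | hp <;> rcases le_total 1 x with h | h
  · have := Real.rpow_le_rpow hpos.le (show 1 - q + q * x ≤ x by nlinarith) hp
    linarith
  · have := Real.rpow_le_rpow hpos.le (show 1 - q + q * x ≤ 1 by nlinarith) hp
    rw [Real.one_rpow] at this
    linarith
  · have := Real.rpow_le_rpow_of_nonpos one_pos (show 1 ≤ 1 - q + q * x by nlinarith) hp
    rw [Real.one_rpow] at this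
    linarith
  · have := Real.rpow_le_rpow_of_nonpos hx (show x ≤ 1 - q + q * x by nlinarith) hp
    linarith

/-- The likelihood ratio `μ₁(z)/μ₀(z)`. -/
def likelihoodRatio (σ z : ℝ) : ℝ := Real.exp ((2 * z - 1) / (2 * σ ^ 2))

theorem likelihoodRatio_pos (σ z : ℝ) : 0 < likelihoodRatio σ z := Real.exp_pos _

theorem likelihoodRatio_one_sub (σ z : ℝ) :
    likelihoodRatio σ (1 - z) = (likelihoodRatio σ z)⁻¹ := by
  rw [likelihoodRatio, likelihoodRatio, ← Real.exp_neg]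
  congr 1
  ring

theorem mu0_mul_likelihoodRatio_rpow {σ : ℝ} (hσ : 0 < σ) (p z : ℝ) :
    mu0 σ z * likelihoodRatio σ z ^ p =
      gaussianPDFReal p ((σ ^ 2).toNNReal) z * Real.exp ((p ^ 2 - p) / (2 * σ ^ 2)) := by
  simp only [mu0, likelihoodRatio, gaussianPDFReal, Real.coe_toNNReal _ (sq_nonneg σ)]
  rw [← Real.exp_mul, mul_assoc, mul_assoc _ (Real.exp (-(z - p) ^ 2 / (2 * σ ^ 2))),
    ← Real.exp_add, ← Real.exp_add]
  congr 2
  field_simp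
  ring

theorem mu1_eq_mu0_mul {σ : ℝ} (hσ : 0 < σ) (z : ℝ) :
    mu1 σ z = mu0 σ z * likelihoodRatio σ z := by
  simpa [mu1] using (mu0_mul_likelihoodRatio_rpow hσ 1 z).symm

theorem mu0_pos {σ : ℝ} (hσ : 0 < σ) (z : ℝ) : 0 < mu0 σ z :=
  gaussianPDFReal_pos _ _ _ (by simpa using hσ.ne')

theorem mu0_one_sub {σ : ℝ} (hσ : 0 < σ) (z : ℝ) :
    mu0 σ (1 - z) = mu0 σ z * likelihoodRatio σ z := by
  rw [← mu1_eq_mu0_mul hσ]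
  simp only [mu0, mu1, gaussianPDFReal]
  congr 3
  ring

theorem muMix_eq_mu0_mul {σ : ℝ} (hσ : 0 < σ) (q z : ℝ) :
    muMix q σ z = mu0 σ z * (1 - q + q * likelihoodRatio σ z) := by
  rw [muMix, mu1_eq_mu0_mul hσ]
  ring

theorem Amom_eq_integral {σ : ℝ} (hσ : 0 < σ) (q α : ℝ) :
    Amom q σ α = ∫ z : ℝ, mu0 σ z * (1 - q + q * likelihoodRatio σ z) ^ α := by
  refine integral_congr_ae (.of_forall fun z => ?_)
  simp only [muMix_eq_mu0_mul hσ, mul_div_cancel_left₀ _ (mu0_pos hσ z).ne']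

theorem Bmom_eq_integral {q σ : ℝ} (hq0 : 0 < q) (hq1 : q ≤ 1) (hσ : 0 < σ) (α : ℝ) :
    Bmom q σ α = ∫ z : ℝ, mu0 σ z * (1 - q + q * likelihoodRatio σ z) ^ (1 - α) := by
  refine integral_congr_ae (.of_forall fun z => ?_)
  have hg := mixture_pos hq0 hq1 (likelihoodRatio_pos σ z)
  have hm := (mu0_pos hσ z).ne'
  simp only [muMix_eq_mu0_mul hσ]
  rw [div_mul_cancel_left₀ hm, Real.inv_rpow hg.le, Real.rpow_sub hg, Real.rpow_one]
  ring

theorem integrable_mu0_mul_mixture_rpow {q σ : ℝ} (hq0 : 0 < q) (hq1 : q ≤ 1) (hσ : 0 < σ)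
    (p : ℝ) :
    Integrable fun z : ℝ => mu0 σ z * (1 - q + q * likelihoodRatio σ z) ^ p := by
  have hint : Integrable fun z : ℝ => mu0 σ z + mu0 σ z * likelihoodRatio σ z ^ p := by
    simp only [mu0_mul_likelihoodRatio_rpow hσ]
    exact (integrable_gaussianPDFReal _ _).add ((integrable_gaussianPDFReal _ _).mul_const _)
  refine hint.mono' ?_ (.of_forall fun z => ?_)
  · have h0 : Measurable (mu0 σ) := measurable_gaussianPDFReal _ _
    have hr : Measurable (likelihoodRatio σ) := by
      unfold likelihoodRatio
      fun_prop
    exact (h0.mul (((hr.const_mul q).const_add (1 - q)).pow_const p)).aestronglyMeasurable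
  · have hr := likelihoodRatio_pos σ z
    have hm := mu0_pos hσ z
    rw [Real.norm_of_nonneg (mul_nonneg hm.le
      (Real.rpow_nonneg (mixture_pos hq0 hq1 hr).le p))]
    linear_combination mul_le_mul_of_nonneg_left (mixture_rpow_le hq0 hq1 hr p) hm.le

theorem Bmom_le_Amom_of_one_le {q σ α : ℝ} (hq0 : 0 < q) (hq1 : q ≤ 1) (hσ : 0 < σ)
    (hα : 1 ≤ α) : Bmom q σ α ≤ Amom q σ α := by
  rw [Amom_eq_integral hσ, Bmom_eq_integral hq0 hq1 hσ]
  set F : ℝ → ℝ → ℝ := fun p z => mu0 σ z * (1 - q + q * likelihoodRatio σ z) ^ p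
  have hF (p : ℝ) : Integrable (F p) := integrable_mu0_mul_mixture_rpow hq0 hq1 hσ p
  have hFr (p : ℝ) : Integrable fun z => F p (1 - z) := (hF p).comp_sub_left 1
  have hsymm (p : ℝ) : ∫ z, (F p z + F p (1 - z)) = 2 * ∫ z, F p z := by
    rw [integral_add (hF p) (hFr p), integral_sub_left_eq_self (F p) volume 1]
    ring
  have hle : ∫ z, (F (1 - α) z + F (1 - α) (1 - z)) ≤ ∫ z, (F α z + F α (1 - z)) := by
    refine integral_mono ((hF _).add (hFr _)) ((hF _).add (hFr _)) fun z => ?_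
    simp only [F, mu0_one_sub hσ, likelihoodRatio_one_sub]
    linear_combination mul_le_mul_of_nonneg_left
      (rpow_one_sub_mixture_le hq0.le hq1 hα (likelihoodRatio_pos σ z)) (mu0_pos hσ z).le
  rw [hsymm, hsymm] at hle
  linarith

/-- For `q ∈ (0,1]`, `σ > 0` and any order `α ≥ 1`, one has `A_α ≥ B_α`; in particular
`max (A_α) (B_α) = A_α`, so the Rényi-divergence bound `(α−1)⁻¹ · log (max A_α B_α)`
for the Sampled Gaussian Mechanism equals `ξ_N(α|q) = (α−1)⁻¹ · log A_α`. -/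
theorem Bmom_le_Amom (q σ : ℝ) (hq0 : 0 < q) (hq1 : q ≤ 1) (hσ : 0 < σ)
    (α : ℝ) (hα : 1 ≤ α) :
    Bmom q σ α ≤ Amom q σ α ∧
    max (Amom q σ α) (Bmom q σ α) = Amom q σ α ∧
    (α - 1)⁻¹ * Real.log (max (Amom q σ α) (Bmom q σ α)) = xiN q σ α := by
  have h := Bmom_le_Amom_of_one_le hq0 hq1 hσ hα
  exact ⟨h, max_eq_left h, by rw [max_eq_left h, xiN]⟩

end
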